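/- arXiv:2106.00678 — 3 statements merged into one kernel-verified Lean document; each statement's English description precedes it below -/
import Mathlib

section
/- Let 𝒰 be a covering uniformity on a frame L and ◁ its uniformly below relation. If b ∈ L satisfies b = sSup {a | a ◁ b}, then b = sSup {a | a ◁ b and a = sSup {a' | a' ◁ a}}; that is, b is the supremum of the elements of the fixed subframe R = {x | x = sSup {y | y ◁ x}} that are uniformly below b. (Key step showing the induced uniformity on the uniform reflection is admissible.) -/
/-- A covering downset on a frame: a lower set whose supremum is the top element. -/
def IsCoveringDownset {L : Type*} [Order.Frame L] (C : Set L) : Prop :=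
  IsLowerSet C ∧ sSup C = ⊤

/-- The star of `a` with respect to `D`: the join of all members of `D` meeting `a`. -/
def frameStar {L : Type*} [Order.Frame L] (a : L) (D : Set L) : L :=
  sSup {u | u ∈ D ∧ a ⊓ u ≠ ⊥}

/-- `U⋆`: the lower closure of the set of stars of members of `U`. -/
def starCover {L : Type*} [Order.Frame L] (U : Set L) : Set L :=
  {x | ∃ u ∈ U, x ≤ frameStar u U}

/-- A covering uniformity on a frame. -/
def IsCoveringUniformity {L : Type*} [Order.Frame L] (𝒰 : Set (Set L)) : Prop :=
  𝒰.Nonempty ∧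
  (∀ U ∈ 𝒰, IsCoveringDownset U) ∧
  (∀ U ∈ 𝒰, ∀ U' : Set L, IsCoveringDownset U' → U ⊆ U' → U' ∈ 𝒰) ∧
  (∀ U ∈ 𝒰, ∀ V ∈ 𝒰, U ∩ V ∈ 𝒰) ∧
  (∀ U ∈ 𝒰, ∃ V ∈ 𝒰, starCover V ⊆ U)

/-- The uniformly below relation of a covering uniformity. -/
def UBelow {L : Type*} [Order.Frame L] (𝒰 : Set (Set L)) (a b : L) : Prop :=
  ∃ U ∈ 𝒰, frameStar a U ≤ b

/-- `↓f[S]`: the lower closure of the image of `S` under `f`. -/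
def imgDown {α β : Type*} [LE β] (f : α → β) (S : Set α) : Set β :=
  {b | ∃ s ∈ S, b ≤ f s}

theorem le_frameStar_of_mem {L : Type*} [Order.Frame L] {a u : L} {D : Set L}
    (hu : u ∈ D) (hau : a ⊓ u ≠ ⊥) : u ≤ frameStar a D :=
  le_sSup ⟨hu, hau⟩

theorem le_frameStar {L : Type*} [Order.Frame L] {D : Set L} (hD : sSup D = ⊤) (a : L) :
    a ≤ frameStar a D := by
  calc
    a = ⨆ u ∈ D, a ⊓ u := by rw [← inf_sSup_eq, hD, inf_top_eq]
    _ ≤ frameStar a D := iSup₂_le fun u hu => by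
      by_cases h : a ⊓ u = ⊥
      · simp [h]
      · exact inf_le_right.trans (le_frameStar_of_mem hu h)

theorem frameStar_mono_left {L : Type*} [Order.Frame L] {a a' : L} (h : a ≤ a') (D : Set L) :
    frameStar a D ≤ frameStar a' D :=
  sSup_le fun _ hu => le_frameStar_of_mem hu.1 fun h' =>
    hu.2 (le_bot_iff.1 ((inf_le_inf_right _ h).trans h'.le))

theorem frameStar_frameStar_le {L : Type*} [Order.Frame L] {U V : Set L}
    (h : starCover V ⊆ U) (a : L) : frameStar (frameStar a V) V ≤ frameStar a U := by
  refine sSup_le fun u hu => ?_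
  obtain ⟨hu, hne⟩ := hu
  have : ∃ v ∈ V, a ⊓ v ≠ ⊥ ∧ v ⊓ u ≠ ⊥ := by
    by_contra! hcon
    refine hne ?_
    rw [frameStar, sSup_inf_eq]
    exact le_bot_iff.1 (iSup₂_le fun v hv => (hcon v hv.1 hv.2).le)
  obtain ⟨v, hv, hav, hvu⟩ := this
  have hvv : v ≤ frameStar v V := le_frameStar_of_mem hv fun h0 => hav (by
    rw [inf_idem] at h0
    rw [h0, inf_bot_eq])
  refine (le_frameStar_of_mem hu hvu).trans
    (le_frameStar_of_mem (h ⟨v, hv, le_rfl⟩) fun h0 => hav ?_)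
  exact le_bot_iff.1 ((inf_le_inf_left a hvv).trans h0.le)

theorem UBelow.mono_left {L : Type*} [Order.Frame L] {𝒰 : Set (Set L)} {a a' b : L}
    (h : UBelow 𝒰 a' b) (ha : a ≤ a') : UBelow 𝒰 a b :=
  let ⟨U, hU, hb⟩ := h
  ⟨U, hU, (frameStar_mono_left ha U).trans hb⟩

theorem UBelow.mono_right {L : Type*} [Order.Frame L] {𝒰 : Set (Set L)} {a b b' : L}
    (h : UBelow 𝒰 a b) (hb : b ≤ b') : UBelow 𝒰 a b' :=
  let ⟨U, hU, hab⟩ := h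
  ⟨U, hU, hab.trans hb⟩

theorem UBelow.le {L : Type*} [Order.Frame L] {𝒰 : Set (Set L)} (h𝒰 : IsCoveringUniformity 𝒰)
    {a b : L} (h : UBelow 𝒰 a b) : a ≤ b :=
  let ⟨U, hU, hb⟩ := h
  (le_frameStar (h𝒰.2.1 U hU).2 a).trans hb

theorem UBelow.exists_between {L : Type*} [Order.Frame L] {𝒰 : Set (Set L)}
    (h𝒰 : IsCoveringUniformity 𝒰) {a b : L} (h : UBelow 𝒰 a b) :
    ∃ c, UBelow 𝒰 a c ∧ UBelow 𝒰 c b := by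
  obtain ⟨U, hU, hb⟩ := h
  obtain ⟨V, hV, hVU⟩ := h𝒰.2.2.2.2 U hU
  exact ⟨frameStar a V, ⟨V, hV, le_rfl⟩, V, hV, (frameStar_frameStar_le hVU a).trans hb⟩

theorem sSup_uBelow_le {L : Type*} [Order.Frame L] {𝒰 : Set (Set L)}
    (h𝒰 : IsCoveringUniformity 𝒰) (c : L) : sSup {a | UBelow 𝒰 a c} ≤ c :=
  sSup_le fun _ ha => UBelow.le h𝒰 ha

/-- The operator sending `c` to the join of the elements uniformly below it is idempotent. -/
theorem sSup_uBelow_idem {L : Type*} [Order.Frame L] {𝒰 : Set (Set L)}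
    (h𝒰 : IsCoveringUniformity 𝒰) (c : L) :
    sSup {a | UBelow 𝒰 a c} = sSup {a' | UBelow 𝒰 a' (sSup {a | UBelow 𝒰 a c})} := by
  refine le_antisymm (sSup_le fun a ha => ?_) (sSup_uBelow_le h𝒰 _)
  obtain ⟨d, had, hdc⟩ := UBelow.exists_between h𝒰 ha
  exact le_sSup (had.mono_right (le_sSup hdc))

theorem admissible_on_fixed_subframe {L : Type*} [Order.Frame L]
    (𝒰 : Set (Set L)) (h𝒰 : IsCoveringUniformity 𝒰)
    (b : L) (hb : b = sSup {a | UBelow 𝒰 a b}) :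
    b = sSup {a | UBelow 𝒰 a b ∧ a = sSup {a' | UBelow 𝒰 a' a}} := by 
  refine le_antisymm (hb.le.trans (sSup_le fun a ha => ?_))
    (sSup_le fun a ha => UBelow.le h𝒰 ha.1)
  obtain ⟨c, hac, hcb⟩ := UBelow.exists_between h𝒰 ha
  exact (le_sSup hac : a ≤ sSup {x | UBelow 𝒰 x c}).trans
    (le_sSup ⟨hcb.mono_left (sSup_uBelow_le h𝒰 c), sSup_uBelow_idem h𝒰 c⟩)
end

section
/- Let L be a frame and R a binary relation on L such that: (a) a R b implies a ≺ b (rather below); (b) R interpolates: a R b implies there exists c with a R c and c R b; and (c) every b ∈ L satisfies b = sSup {a | a R b} (L is strongly regular, witnessed by R). Then there exists an admissible covering uniformity on L. (Classical rendering of the proposition that strongly regular overt locales are uniformisable; overtness is automatic classically.) -/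
section CoveringDownsets

variable {L : Type*} [Order.Frame L]

theorem isCoveringDownset_univ : IsCoveringDownset (Set.univ : Set L) :=
  ⟨isLowerSet_univ, sSup_univ⟩

theorem IsCoveringDownset.inter {U V : Set L} (hU : IsCoveringDownset U)
    (hV : IsCoveringDownset V) : IsCoveringDownset (U ∩ V) := by
  refine ⟨hU.1.inter hV.1, top_le_iff.1 ?_⟩
  calc (⊤ : L) = sSup U ⊓ sSup V := by rw [hU.2, hV.2, inf_top_eq]
    _ ≤ sSup (U ∩ V) := by
      rw [sSup_inf_sSup]
      refine iSup₂_le fun p hp => le_sSup ⟨?_, ?_⟩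
      · exact hU.1 inf_le_left hp.1
      · exact hV.1 inf_le_right hp.2

theorem frameStar_mono {U V : Set L} (h : U ⊆ V) (a : L) : frameStar a U ≤ frameStar a V :=
  sSup_le_sSup fun _ hu => ⟨h hu.1, hu.2⟩

theorem starCover_mono {U V : Set L} (h : U ⊆ V) : starCover U ⊆ starCover V := by
  rintro x ⟨u, hu, hx⟩
  exact ⟨u, h hu, hx.trans (frameStar_mono h u)⟩

theorem IsCoveringDownset.le_frameStar {U : Set L} (hU : IsCoveringDownset U) (a : L) :
    a ≤ frameStar a U := by
  calc a = a ⊓ sSup U := by rw [hU.2, inf_top_eq]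
    _ ≤ frameStar a U := by
      rw [inf_sSup_eq]
      refine iSup₂_le fun u hu => ?_
      by_cases h : a ⊓ u = ⊥
      · exact h.trans_le bot_le
      · exact inf_le_right.trans (le_sSup ⟨hu, h⟩)

/-- The lower set generated by the pseudocomplement of `a` and by `b`. -/
def separatingDownset (a b : L) : Set L := {x | x ≤ aᶜ ∨ x ≤ b}

theorem isCoveringDownset_separatingDownset {a b : L}
    (h : ∃ c : L, c ⊓ a = ⊥ ∧ c ⊔ b = ⊤) : IsCoveringDownset (separatingDownset a b) := by
  obtain ⟨c, hca, hcb⟩ := h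
  refine ⟨fun x y hyx hx => hx.imp hyx.trans hyx.trans, top_le_iff.1 ?_⟩
  rw [← hcb]
  exact sup_le (le_sSup (Or.inl (le_compl_iff_disjoint_right.2 (disjoint_iff.2 hca))))
    (le_sSup (Or.inr le_rfl))

/-- A member of `separatingDownset a b` that meets an element below `a` is below `b`. -/
theorem le_of_mem_separatingDownset {a b x y : L} (hy : y ∈ separatingDownset a b)
    (hx : x ≤ a) (hxy : x ⊓ y ≠ ⊥) : y ≤ b := by
  refine hy.resolve_left fun h => hxy ?_
  exact disjoint_iff.1 ((le_compl_iff_disjoint_left.1 h).mono_left hx)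

/-- A member of `separatingDownset a b` that meets an element below `bᶜ` is below `aᶜ`. -/
theorem le_compl_of_mem_separatingDownset {a b x y : L} (hy : y ∈ separatingDownset a b)
    (hx : x ≤ bᶜ) (hxy : x ⊓ y ≠ ⊥) : y ≤ aᶜ := by
  refine hy.resolve_right fun h => hxy ?_
  exact disjoint_iff.1 ((le_compl_iff_disjoint_right.1 hx).mono_right h)

theorem frameStar_separatingDownset_le (a b : L) : frameStar a (separatingDownset a b) ≤ b :=
  sSup_le fun _ hu => le_of_mem_separatingDownset hu.1 le_rfl hu.2

theorem starCover_separatingDownset_subset (a c d b : L) :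
    starCover (separatingDownset a c ∩ (separatingDownset c d ∩ separatingDownset d b)) ⊆
      separatingDownset a b := by
  rintro x ⟨u, ⟨-, hu | hu, -⟩, hx⟩
  · exact Or.inl (hx.trans (sSup_le fun y hy =>
      le_compl_of_mem_separatingDownset hy.1.1 hu hy.2))
  · exact Or.inr (hx.trans (sSup_le fun y hy =>
      le_of_mem_separatingDownset hy.1.2.2 hu hy.2))

/-- The filter of covering downsets generated by `separatingDownset a b` for `R a b`. -/
inductive GeneratedCover (R : L → L → Prop) : Set L → Prop
  | univ : GeneratedCover R Set.univ
  | basic {a b : L} : R a b → GeneratedCover R (separatingDownset a b)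
  | inter {U V : Set L} : GeneratedCover R U → GeneratedCover R V → GeneratedCover R (U ∩ V)
  | mono {U V : Set L} : GeneratedCover R U → IsCoveringDownset V → U ⊆ V → GeneratedCover R V

theorem GeneratedCover.isCoveringDownset {R : L → L → Prop}
    (hrb : ∀ a b : L, R a b → ∃ c : L, c ⊓ a = ⊥ ∧ c ⊔ b = ⊤) {U : Set L}
    (hU : GeneratedCover R U) : IsCoveringDownset U := by
  induction hU with
  | univ => exact isCoveringDownset_univ
  | basic h => exact isCoveringDownset_separatingDownset (hrb _ _ h)
  | inter _ _ hU hV => exact hU.inter hV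
  | mono _ hV _ _ => exact hV

theorem GeneratedCover.exists_starCover_subset {R : L → L → Prop}
    (hint : ∀ a b : L, R a b → ∃ c : L, R a c ∧ R c b) {U : Set L}
    (hU : GeneratedCover R U) : ∃ V, GeneratedCover R V ∧ starCover V ⊆ U := by
  induction hU with
  | univ => exact ⟨Set.univ, .univ, Set.subset_univ _⟩
  | @basic a b h =>
    obtain ⟨c, hac, hcb⟩ := hint a b h
    obtain ⟨d, hcd, hdb⟩ := hint c b hcb
    exact ⟨_, .inter (.basic hac) (.inter (.basic hcd) (.basic hdb)),
      starCover_separatingDownset_subset a c d b⟩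
  | inter _ _ hU hV =>
    obtain ⟨U', hU', hUs⟩ := hU
    obtain ⟨V', hV', hVs⟩ := hV
    exact ⟨U' ∩ V', .inter hU' hV', Set.subset_inter
      ((starCover_mono Set.inter_subset_left).trans hUs)
      ((starCover_mono Set.inter_subset_right).trans hVs)⟩
  | mono _ _ hUV ih =>
    obtain ⟨W, hW, hWs⟩ := ih
    exact ⟨W, hW, hWs.trans hUV⟩

end CoveringDownsets

theorem stronglyRegular_uniformisable {L : Type*} [Order.Frame L]
    (R : L → L → Prop)
    (hrb : ∀ a b : L, R a b → ∃ c : L, c ⊓ a = ⊥ ∧ c ⊔ b = ⊤)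
    (hint : ∀ a b : L, R a b → ∃ c : L, R a c ∧ R c b)
    (hreg : ∀ b : L, b = sSup {a | R a b}) :
    ∃ 𝒰 : Set (Set L), IsCoveringUniformity 𝒰 ∧
      ∀ b : L, b = sSup {a | UBelow 𝒰 a b} := by
  refine ⟨{U | GeneratedCover R U}, ⟨⟨_, .univ⟩, fun U hU => hU.isCoveringDownset hrb,
    fun U hU U' hU' h => .mono hU hU' h, fun U hU V hV => .inter hU hV,
    fun U hU => hU.exists_starCover_subset hint⟩, fun b => le_antisymm ?_ ?_⟩
  · conv_lhs => rw [hreg b]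
    exact sSup_le_sSup fun a ha =>
      ⟨separatingDownset a b, .basic ha, frameStar_separatingDownset_le a b⟩
  · refine sSup_le ?_
    rintro a ⟨U, hU, hab⟩
    exact ((hU.isCoveringDownset hrb).le_frameStar a).trans hab
end

section
/- Let j : B → A be a surjective dense frame homomorphism with right adjoint j⁎, let 𝒱 be an admissible covering uniformity on B, and let 𝒰 be the initial (embedding) uniformity on A, i.e. 𝒰 = {U | U is a covering downset on A and ↓j[V] ⊆ U for some V ∈ 𝒱}, with uniformly below relation ◁ on A. Then j⁎ is an indexed regular Cauchy filter: (i) j⁎(⊤) = ⊤ and j⁎(a ⊓ a') = j⁎(a) ⊓ j⁎(a') for all a, a' ∈ A; (ii) j⁎(⊥) = ⊥; (iii) for every U ∈ 𝒰, sSup {j⁎(u) | u ∈ U} = ⊤; (iv) j⁎(a) ≤ sSup {j⁎(b) | b ◁ a} for every a ∈ A. -/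
/-- The lower closure of the image of a covering downset under a frame homomorphism is again a
covering downset. -/
theorem IsCoveringDownset.map {A B : Type*} [Order.Frame A] [Order.Frame B] (j : FrameHom B A)
    {V : Set B} (hV : IsCoveringDownset V) : IsCoveringDownset (imgDown j V) := by
  refine ⟨fun x y hyx ⟨s, hs, hxs⟩ => ⟨s, hs, hyx.trans hxs⟩, top_le_iff.mp ?_⟩
  rw [← map_top j, ← hV.2, map_sSup]
  refine sSup_le_sSup ?_
  rintro _ ⟨v, hv, rfl⟩
  exact ⟨v, hv, le_rfl⟩

/-- Stars with respect to the image of `V` under `j` are bounded by the image of stars with respect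
to `V`, for any frame homomorphism `j`. -/
theorem frameStar_imgDown_le {A B : Type*} [Order.Frame A] [Order.Frame B] (j : FrameHom B A)
    (x : B) (V : Set B) : frameStar (j x) (imgDown j V) ≤ j (frameStar x V) := by
  refine sSup_le ?_
  rintro u ⟨⟨v, hv, huv⟩, hne⟩
  refine huv.trans (OrderHomClass.mono j (le_sSup ⟨hv, fun h => hne (le_bot_iff.mp ?_)⟩))
  calc j x ⊓ u ≤ j x ⊓ j v := inf_le_inf_left _ huv
    _ = j (x ⊓ v) := (map_inf j x v).symm
    _ ≤ ⊥ := by rw [h, map_bot]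

theorem right_adjoint_indexed_regular_cauchy_filter {A B : Type*}
    [Order.Frame A] [Order.Frame B]
    (j : FrameHom B A) (hsurj : Function.Surjective j)
    (hdense : ∀ b : B, j b = ⊥ → b = ⊥)
    (jstar : A → B) (hadj : ∀ (a : A) (b : B), j b ≤ a ↔ b ≤ jstar a)
    (𝒱 : Set (Set B)) (h𝒱 : IsCoveringUniformity 𝒱)
    (hadm : ∀ b : B, b = sSup {a | UBelow 𝒱 a b})
    (𝒰 : Set (Set A))
    (h𝒰 : 𝒰 = {U | IsCoveringDownset U ∧ ∃ V ∈ 𝒱, imgDown j V ⊆ U}) :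
    (jstar ⊤ = ⊤ ∧ ∀ a a' : A, jstar (a ⊓ a') = jstar a ⊓ jstar a') ∧
    jstar ⊥ = ⊥ ∧
    (∀ U ∈ 𝒰, sSup (jstar '' U) = ⊤) ∧
    (∀ a : A, jstar a ≤ sSup (jstar '' {b | UBelow 𝒰 b a})) := by
  have gc : GaloisConnection j jstar := fun b a => hadj a b
  subst h𝒰
  refine ⟨⟨gc.u_top, fun a a' => gc.u_inf⟩, ?_, ?_, ?_⟩
  · exact hdense _ (le_bot_iff.mp (gc.l_u_le ⊥))
  · rintro U ⟨-, V, hV, hVU⟩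
    rw [← top_le_iff, ← (h𝒱.2.1 V hV).2]
    exact sSup_le fun v hv => (gc.le_u_l v).trans
      (le_sSup (Set.mem_image_of_mem jstar (hVU ⟨v, hv, le_rfl⟩)))
  · intro a
    conv_lhs => rw [hadm (jstar a)]
    refine sSup_le ?_
    rintro x ⟨V, hV, hx⟩
    refine (gc.le_u_l x).trans (le_sSup (Set.mem_image_of_mem jstar ?_))
    exact ⟨imgDown j V, ⟨(h𝒱.2.1 V hV).map j, V, hV, subset_rfl⟩,
      (frameStar_imgDown_le j x V).trans ((hadj _ _).mpr hx)⟩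
end
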